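/- Let Θ_{i_1}, ..., Θ_{i_m} be one-variable inner functions in distinct variables with extensions Θ̃_{i_j} to 𝔻ⁿ, and let Q = H²(𝔻ⁿ) ⊖ (Θ̃_{i_1} H²(𝔻ⁿ) + ... + Θ̃_{i_m} H²(𝔻ⁿ)). Then Q is a doubly commuting quotient module: C_{z_s} C_{z_t}^* = C_{z_t}^* C_{z_s} for all s ≠ t, where C_{z_i} = P_Q M_{z_i}|_Q. -/

import Mathlib

open ContinuousLinearMap

open scoped InnerProductSpace

namespace DCQ

lemma ind {n : ℕ} {P : (Fin n → ℕ) → Prop} (h0 : P 0)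
    (hs : ∀ k i, P k → P (k + Pi.single i 1)) (k : Fin n → ℕ) : P k := by
  obtain ⟨N, hN⟩ : ∃ N, ∑ i, k i = N := ⟨_, rfl⟩
  induction N generalizing k with
  | zero =>
    have : k = 0 := by
      funext i
      have := (Finset.sum_eq_zero_iff.mp hN) i (Finset.mem_univ i)
      simpa using this
    rw [this]; exact h0
  | succ N ih =>
    have : ∃ i, k i ≠ 0 := by
      by_contra! h
      simp [h] at hN
    obtain ⟨i, hi⟩ := this
    have hk : k = (k - Pi.single i 1) + Pi.single i 1 := by
      funext j
      by_cases hj : j = i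
      · subst hj; simp; omega
      · simp [hj]
    rw [hk]
    apply hs
    apply ih
    rw [hk] at hN
    simp only [Pi.add_apply, Finset.sum_add_distrib, Finset.sum_pi_single', Finset.mem_univ, if_true] at hN
    simpa using hN

variable {H : Type*} [NormedAddCommGroup H] [InnerProductSpace ℂ H] [CompleteSpace H]

lemma adjL (A : H →L[ℂ] H) (x y : H) : ⟪(star A) x, y⟫_ℂ = ⟪x, A y⟫_ℂ := by
  rw [star_eq_adjoint, adjoint_inner_left]

lemma adjR (A : H →L[ℂ] H) (x y : H) : ⟪x, (star A) y⟫_ℂ = ⟪A x, y⟫_ℂ := by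
  rw [star_eq_adjoint, adjoint_inner_right]

lemma cm {A B : H →L[ℂ] H} (h : Commute A B) (x : H) : A (B x) = B (A x) := by
  have := congrArg (fun f : H →L[ℂ] H => f x) h.eq
  simpa using this

lemma mulA (A B : H →L[ℂ] H) (x : H) : (A * B) x = A (B x) := rfl

lemma oneA (x : H) : (1 : H →L[ℂ] H) x = x := rfl

/-- An orthonormal total family with the shifts. -/
structure Sh {n : ℕ} (e : (Fin n → ℕ) → H) (S : Fin n → (H →L[ℂ] H)) : Prop where
  on : Orthonormal ℂ e
  tot : ∀ x, (∀ k, ⟪e k, x⟫_ℂ = 0) → x = 0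
  sh : ∀ i k, S i (e k) = e (k + Pi.single i 1)

variable {n : ℕ} {e : (Fin n → ℕ) → H} {S : Fin n → (H →L[ℂ] H)}

lemma Sh.ext (h : Sh e S) {x y : H} (hxy : ∀ k, ⟪e k, x⟫_ℂ = ⟪e k, y⟫_ℂ) : x = y := by
  rw [← sub_eq_zero]
  apply h.tot
  intro k
  rw [inner_sub_right, hxy, sub_self]

lemma Sh.opext (h : Sh e S) {A B : H →L[ℂ] H} (hAB : ∀ k, A (e k) = B (e k)) : A = B := by
  have : star A = star B := by
    ext x
    apply h.ext
    intro k
    rw [adjR, adjR, hAB]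
  exact star_injective this

lemma Sh.comm (h : Sh e S) (i j : Fin n) : Commute (S i) (S j) := by
  show S i * S j = S j * S i
  apply h.opext
  intro k
  simp only [mulA, h.sh]
  rw [add_right_comm]

lemma Sh.iso (h : Sh e S) (i : Fin n) : star (S i) * S i = 1 := by
  apply h.opext
  intro k
  apply h.ext
  intro q
  simp only [mulA, adjR, h.sh, oneA]
  rw [orthonormal_iff_ite.mp h.on, orthonormal_iff_ite.mp h.on]
  simp

lemma Sh.iso' (h : Sh e S) (i : Fin n) (x : H) : star (S i) (S i x) = x := by
  have := congrArg (fun f : H →L[ℂ] H => f x) (h.iso i)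
  simpa using this

lemma Sh.adj_zero (h : Sh e S) (i : Fin n) (k : Fin n → ℕ) (hk : k i = 0) :
    star (S i) (e k) = 0 := by
  apply h.tot
  intro q
  rw [adjR, h.sh]
  apply h.on.2
  intro hq
  have := congrFun hq i
  simp [hk] at this

lemma Sh.adj_shift (h : Sh e S) (i : Fin n) (k : Fin n → ℕ) :
    star (S i) (e (k + Pi.single i 1)) = e k := by
  rw [← h.sh, h.iso']

lemma splitAt (k : Fin n → ℕ) (i : Fin n) (hi : k i ≠ 0) :
    ∃ k' : Fin n → ℕ, k = k' + Pi.single i 1 ∧ k i = k' i + 1 := by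
  have hk : k = (k - Pi.single i 1) + Pi.single i 1 := by
    funext j
    by_cases hj : j = i
    · subst hj; simp; omega
    · simp [hj]
  exact ⟨_, hk, by simp; omega⟩

lemma Sh.dcomm (h : Sh e S) {s t : Fin n} (hst : s ≠ t) : Commute (S s) (star (S t)) := by
  apply h.opext
  intro k
  simp only [mulA]
  by_cases hk : k t = 0
  · rw [h.adj_zero t k hk, h.sh, h.adj_zero, map_zero]
    simp [hk, hst.symm]
  · obtain ⟨k', rfl, -⟩ := splitAt k t hk
    rw [h.adj_shift, h.sh, h.sh, add_right_comm, h.adj_shift]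

lemma Sh.const (h : Sh e S) (z : H) (hz : ∀ i, star (S i) z = 0) : z = ⟪e 0, z⟫_ℂ • e 0 := by
  apply h.ext
  intro k
  rw [inner_smul_right, orthonormal_iff_ite.mp h.on]
  by_cases hk : k = 0
  · simp [hk]
  · have : ∃ i, k i ≠ 0 := by
      by_contra! h'
      exact hk (funext h')
    obtain ⟨i, hi⟩ := this
    obtain ⟨k', rfl, -⟩ := splitAt k i hi
    rw [if_neg hk, mul_zero, ← h.sh, ← adjR, hz, inner_zero_right]

lemma Sh.decomp (h : Sh e S) (i : Fin n) (N : ℕ) :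
    ∀ y : H, (∀ i', i' ≠ i → star (S i') y = 0) →
    ∃ (A : H →L[ℂ] H) (w : H), (∀ B, Commute B (S i) → Commute B A) ∧
      y = A (e 0) + (S i ^ N) w := by
  induction N with
  | zero => exact fun y _ => ⟨0, y, fun B _ => Commute.zero_right B, by simp⟩
  | succ N ih =>
    intro y hy
    have hy' : ∀ i', i' ≠ i → star (S i') (star (S i) y) = 0 := by
      intro i' hi'
      rw [cm ((h.comm i' i).star_star), hy i' hi', map_zero]
    obtain ⟨A, w, hA, hw⟩ := ih (star (S i) y) hy'
    have hz := h.const (y - S i (star (S i) y)) (by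
      intro i'
      by_cases hi : i' = i
      · subst hi
        rw [map_sub, h.iso', sub_self]
      · rw [map_sub, ← cm (h.dcomm (Ne.symm hi)), hy' i' hi, hy i' hi]; simp)
    set c := ⟪e 0, y - S i (star (S i) y)⟫_ℂ
    refine ⟨c • 1 + S i * A, w, ?_, ?_⟩
    · intro B hB
      exact ((Commute.one_right B).smul_right c).add_right (hB.mul_right (hA B hB))
    · rw [sub_eq_iff_eq_add, hw, map_add] at hz
      rw [hz, pow_succ']
      simp [add_assoc]

/-- The adjoint of a one-variable multiplier is locally a polynomial in the backward shift. -/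
lemma Sh.key (h : Sh e S) (i : Fin n) (T : H →L[ℂ] H) (hT : ∀ i, Commute T (S i))
    (hT' : ∀ i', i' ≠ i → Commute T (star (S i'))) (N : ℕ) :
    ∃ A : H →L[ℂ] H, (∀ B, Commute B (S i) → Commute B A) ∧
      ∀ x, (star (S i) ^ N) x = 0 → star T x = star A x := by
  obtain ⟨A, w, hA, hw⟩ := h.decomp i N (T (e 0)) (by
    intro i' hi'
    rw [← cm (hT' i' hi'), h.adj_zero _ _ rfl, map_zero])
  refine ⟨A, hA, ?_⟩
  intro x hx
  have hr : ∀ r, ∃ w, T (e r) = A (e r) + (S i ^ N) w := by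
    apply ind
    · exact ⟨w, hw⟩
    · rintro k j ⟨w, hw⟩
      refine ⟨S j w, ?_⟩
      rw [← h.sh, cm (hT j), hw, map_add, cm (hA _ (h.comm j i)), cm ((h.comm j i).pow_right N)]
  apply h.ext
  intro k
  rw [adjR, adjR]
  obtain ⟨w, hw⟩ := hr k
  rw [hw, inner_add_left, ← adjR (S i ^ N), star_pow, hx, inner_zero_right, add_zero]

lemma Sh.nil (h : Sh e S) (i : Fin n) (k : Fin n → ℕ) : (star (S i) ^ (k i + 1)) (e k) = 0 := by
  obtain ⟨N, hN⟩ : ∃ N, k i = N := ⟨_, rfl⟩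
  rw [hN]
  induction N generalizing k with
  | zero => simpa using h.adj_zero i k hN
  | succ N ih =>
    obtain ⟨k', rfl, h2⟩ := splitAt k i (by omega)
    rw [pow_succ, mulA, h.adj_shift]
    exact ih k' (by omega)

lemma Sh.main1 (h : Sh e S) {i j : Fin n} (hij : i ≠ j) (T R : H →L[ℂ] H)
    (hT : ∀ i, Commute T (S i)) (hR : ∀ i, Commute R (S i))
    (hT' : ∀ i', i' ≠ i → Commute T (star (S i')))
    (hR' : ∀ i', i' ≠ j → Commute R (star (S i'))) :
    Commute (star T) R ∧ Commute T R := by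
  constructor
  · apply h.opext
    intro q
    obtain ⟨A, hA, hx⟩ := h.key i T hT hT' (q i + 1)
    have h1 : Commute R (star A) := by
      have : Commute (star R) (S i) := by simpa using (hR' i hij).star_star
      simpa using (hA _ this).star_star
    rw [mulA, mulA, hx _ (h.nil i q), hx, cm h1]
    rw [← cm ((hR' i hij).pow_right _), h.nil, map_zero]
  · have : Commute (star T) (star R) := by
      apply h.opext
      intro q
      obtain ⟨A, hA, hx⟩ := h.key i T hT hT' (q i + 1)
      have h1 : Commute (star R) (star A) := (hA _ (hR i)).star_star
      rw [mulA, mulA, hx _ (h.nil i q), hx, cm h1]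
      rw [← cm (((hR i).star_star).pow_right _), h.nil, map_zero]
    simpa using this.star_star

theorem Sh.main (h : Sh e S) (m : ℕ) (ι : Fin m → Fin n) (hι : StrictMono ι)
    (T : Fin m → (H →L[ℂ] H))
    (hTiso : ∀ j x, ‖T j x‖ = ‖x‖)
    (hTmult : ∀ j i, Commute (T j) (S i))
    (hTvar : ∀ j i, i ≠ ι j → Commute (T j) (star (S i)))
    (Q : Submodule ℂ H)
    (hQ : Q = (⨆ j : Fin m, LinearMap.range ((T j) : H →ₗ[ℂ] H))ᗮ)
    (PQ : H →L[ℂ] H)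
    (hPQsa : star PQ = PQ) (hPQidem : PQ * PQ = PQ)
    (hPQrange : Set.range PQ = (Q : Set H)) :
    (∀ i, ∀ x ∈ Q, star (S i) x ∈ Q) ∧
    (∀ s t, s ≠ t → Commute (PQ * (S s * PQ)) (star (PQ * (S t * PQ)))) := by
  have mem : ∀ x, x ∈ Q ↔ ∀ j, star (T j) x = 0 := by
    intro x
    rw [hQ, ← Submodule.iInf_orthogonal, Submodule.mem_iInf]
    refine forall_congr' fun j => ?_
    rw [Submodule.mem_orthogonal]
    constructor
    · intro hx
      apply h.tot
      intro k
      rw [adjR]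
      exact hx _ ⟨_, rfl⟩
    · rintro hx _ ⟨y, rfl⟩
      have := adjR (T j) y x
      rw [hx, inner_zero_right] at this
      exact this.symm
  have TT : ∀ j x, star (T j) (T j x) = x := by
    intro j x
    have := (norm_map_iff_adjoint_comp_self (T j)).mp (hTiso j)
    have := congrArg (fun f : H →L[ℂ] H => f x) this
    simpa [star_eq_adjoint] using this
  have inv : ∀ i, ∀ x ∈ Q, star (S i) x ∈ Q := by
    intro i x hx
    rw [mem] at hx ⊢
    intro j
    rw [cm ((hTmult j i).star_star), hx j, map_zero]
  have PQmem : ∀ x, PQ x ∈ Q := by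
    intro x
    have : PQ x ∈ (Q : Set H) := hPQrange ▸ ⟨x, rfl⟩
    exact this
  have PQid : ∀ x ∈ Q, PQ x = x := by
    intro x hx
    have : x ∈ Set.range PQ := hPQrange ▸ hx
    obtain ⟨y, rfl⟩ := this
    exact congrArg (fun f : H →L[ℂ] H => f y) hPQidem
  have PQT : ∀ j x, PQ (T j x) = 0 := by
    intro j x
    apply h.tot
    intro k
    rw [← hPQsa, adjR, ← adjL, (mem _).mp (PQmem _) j, inner_zero_left]
  have P1 : ∀ t x, PQ (star (S t) (PQ x)) = star (S t) (PQ x) := fun t x =>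
    PQid _ (inv t _ (PQmem x))
  have adjI : ∀ t, star (PQ * (S t * PQ)) = star (S t) * PQ := by
    intro t
    rw [star_mul, star_mul, hPQsa]
    ext x
    simp only [mulA]
    exact P1 t x
  refine ⟨inv, fun s t hst => ?_⟩
  rw [adjI]
  -- the core claim
  have core : ∀ x ∈ Q, PQ (star (S t) (PQ (S s x))) = PQ (star (S t) (S s x)) := by
    intro x hx
    have hx' := (mem x).mp hx
    have cs : ∀ k, ι k ≠ s → star (T k) (S s x) = 0 := by
      intro k hk
      have : Commute (star (T k)) (S s) := by
        simpa using (hTvar k s (Ne.symm hk)).star_star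
      rw [cm this, hx' k, map_zero]
    by_cases hs : ∃ j, ι j = s
    · obtain ⟨j, hj⟩ := hs
      have hin : S s x - T j (star (T j) (S s x)) ∈ Q := by
        rw [mem]
        intro k
        rw [map_sub]
        by_cases hk : k = j
        · subst hk
          rw [TT, sub_self]
        · have hne : ι k ≠ ι j := fun h' => hk (hι.injective h')
          obtain ⟨c1, c2⟩ := h.main1 hne (T k) (T j) (hTmult k) (hTmult j) (hTvar k) (hTvar j)
          rw [cm c1, cm c2.star_star, cs k (by rwa [← hj])]
          simp
      have h1 : PQ (S s x) = S s x - T j (star (T j) (S s x)) := by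
        have := PQid _ hin
        rwa [map_sub, PQT, sub_zero] at this
      rw [h1, map_sub, ← cm (hTvar j t (by rw [hj]; exact hst.symm)), map_sub, PQT, sub_zero]
    · have : S s x ∈ Q := (mem _).mpr fun k => cs k fun hk => hs ⟨k, hk⟩
      rw [PQid _ this]
  ext x
  simp only [mulA]
  rw [P1, PQid _ (PQmem (S s (PQ x))), ← P1 t (S s (PQ x)), core _ (PQmem x), cm (h.dcomm hst)]

end DCQ

/-- Realize `H²(𝔻ⁿ) ≅ ℓ²(ℕⁿ)` with coordinate shifts `S i`.  Let
`Θ_{i_1}, …, Θ_{i_m}` be one-variable inner functions in distinct variables `i_1 < ⋯ < i_m`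
(a strictly monotone `ι : Fin m → Fin n`), with extensions `Θ̃_{i_j}` and multiplication
operators `T j = M_{Θ̃_{i_j}}` (isometries commuting with every shift, and with `(S i)*` for
`i ≠ ι j`).  Let `Q = H²(𝔻ⁿ) ⊖ (Θ̃_{i_1} H²(𝔻ⁿ) + ⋯ + Θ̃_{i_m} H²(𝔻ⁿ))`, the orthogonal
complement of the sum of the ranges of the `T j`, with orthogonal projection `PQ`.  Then `Q` is
a doubly commuting quotient module: `Q` is invariant under every `(S i)*`, and the compressions
`C_{z_i}` (encoded as `A i = PQ ∘ S i ∘ PQ`) satisfy `C_{z_s} C_{z_t}* = C_{z_t}* C_{z_s}` for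
all `s ≠ t`. -/
theorem complement_of_sum_of_extended_inner_ranges_doubly_commuting
    {n : ℕ}
    (S : Fin n → (lp (fun _ : Fin n → ℕ => ℂ) 2 →L[ℂ] lp (fun _ : Fin n → ℕ => ℂ) 2))
    (hS : ∀ (i : Fin n) (k : Fin n → ℕ),
      S i (lp.single 2 k (1 : ℂ)) = lp.single 2 (k + Pi.single i 1) (1 : ℂ))
    (m : ℕ) (ι : Fin m → Fin n) (hι : StrictMono ι)
    (T : Fin m → (lp (fun _ : Fin n → ℕ => ℂ) 2 →L[ℂ] lp (fun _ : Fin n → ℕ => ℂ) 2))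
    (hTiso : ∀ j x, ‖T j x‖ = ‖x‖)
    (hTmult : ∀ j i, T j ∘L S i = S i ∘L T j)
    (hTvar : ∀ j i, i ≠ ι j →
      T j ∘L ContinuousLinearMap.adjoint (S i)
        = ContinuousLinearMap.adjoint (S i) ∘L T j)
    (Q : Submodule ℂ (lp (fun _ : Fin n → ℕ => ℂ) 2))
    (hQ : Q = (⨆ j : Fin m, LinearMap.range ((T j) : lp (fun _ : Fin n → ℕ => ℂ) 2 →ₗ[ℂ]
      lp (fun _ : Fin n → ℕ => ℂ) 2))ᗮ)
    (PQ : lp (fun _ : Fin n → ℕ => ℂ) 2 →L[ℂ] lp (fun _ : Fin n → ℕ => ℂ) 2)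
    (hPQsa : IsSelfAdjoint PQ) (hPQidem : PQ ∘L PQ = PQ)
    (hPQrange : Set.range PQ = (Q : Set (lp (fun _ : Fin n → ℕ => ℂ) 2))) :
    (∀ i, ∀ x ∈ Q, ContinuousLinearMap.adjoint (S i) x ∈ Q) ∧
    (∀ s t, s ≠ t →
      (PQ ∘L S s ∘L PQ) ∘L ContinuousLinearMap.adjoint (PQ ∘L S t ∘L PQ)
        = ContinuousLinearMap.adjoint (PQ ∘L S t ∘L PQ) ∘L (PQ ∘L S s ∘L PQ)) := by
  have hsh : DCQ.Sh (fun k : Fin n → ℕ => (lp.single 2 k (1 : ℂ) : lp (fun _ : Fin n → ℕ => ℂ) 2)) S := by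
    refine ⟨?_, ?_, hS⟩
    · rw [orthonormal_iff_ite]
      intro i j
      rw [lp.inner_single_left]
      simp [lp.single_apply, Pi.single_apply]
    · intro x hx
      ext k
      have := hx k
      rw [lp.inner_single_left] at this
      simpa using this
  exact hsh.main m ι hι T hTiso hTmult hTvar Q hQ PQ hPQsa hPQidem hPQrange
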